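/- Assume in addition that α + β + γ + αβγ = 0, and set c₀ := 0, c₁ := ℓ₀₃(1+ℓ₀₁), c₂ := 1+ℓ₀₂, c₃ := 1+ℓ₀₃. Then for each ν ∈ {0,1,2,3} one has (c_{μ_ν} − c_{ν̃}) p_{μ_ν ν} + (c_{μ̃_ν} − c_{ν̃}) p_{μ̃_ν ν} = 0; consequently, for every unital associative ℂ-algebra A and every x : {0,1,2,3} → A satisfying the A_{ℓ,p}-relations for these parameters, the element ℓ₀₃(1+ℓ₀₁) x₁² + (1+ℓ₀₂) x₂² + (1+ℓ₀₃) x₃² commutes with x_ν for every ν. -/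

import Mathlib

open Complex

/-- For distinct `μ ν`, `pr μ ν = (μ', ν')`, the unique pair with
`{μ', ν'} = {0,1,2,3} \ {μ, ν}` and `μ' > ν'` iff `μ > ν`; `pr μ μ = (μ, μ)`. -/
def pr : Fin 4 → Fin 4 → Fin 4 × Fin 4 :=
  ![![(0,0),(2,3),(1,3),(1,2)],
    ![(3,2),(1,1),(0,3),(0,2)],
    ![(3,1),(3,0),(2,2),(0,1)],
    ![(2,1),(2,0),(1,0),(3,3)]]

/-- The table `ν ↦ (ν̃, μ_ν, μ̃_ν)`. -/
def tnu : Fin 4 → Fin 4 × Fin 4 × Fin 4 :=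
  ![(1,2,3),(0,3,2),(3,0,1),(2,1,0)]

/-- The Sklyanin parameters `ℓ_{μν}`: `ℓ₀₁ = (1−α)/(1+α)`, `ℓ₀₂ = (1+β)/(1−β)`,
`ℓ₀₃ = (1−γ)/(1+γ)`, extended by `ℓ_{μμ} = 1`, `ℓ_{μν} = ℓ_{νμ} = ℓ_{μ'ν'}`. -/
noncomputable def sklL (α β γ : ℂ) : Fin 4 → Fin 4 → ℂ :=
  ![![1, (1-α)/(1+α), (1+β)/(1-β), (1-γ)/(1+γ)],
    ![(1-α)/(1+α), 1, (1-γ)/(1+γ), (1+β)/(1-β)],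
    ![(1+β)/(1-β), (1-γ)/(1+γ), 1, (1-α)/(1+α)],
    ![(1-γ)/(1+γ), (1+β)/(1-β), (1-α)/(1+α), 1]]

/-- The Sklyanin parameters `p_{μν}`: `p₀₁ = 2iα/(1+α)`, `p₂₃ = 2i/(1+α)`,
`p₀₂ = 2iβ/(1−β)`, `p₁₃ = −2i/(1−β)`, `p₀₃ = 2iγ/(1+γ)`, `p₁₂ = 2i/(1+γ)`,
extended by `p_{μν} = −p_{νμ}`, `p_{μμ} = 0`. -/
noncomputable def sklP (α β γ : ℂ) : Fin 4 → Fin 4 → ℂ :=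
  ![![0, 2*I*α/(1+α), 2*I*β/(1-β), 2*I*γ/(1+γ)],
    ![-(2*I*α/(1+α)), 0, 2*I/(1+γ), -(2*I)/(1-β)],
    ![-(2*I*β/(1-β)), -(2*I/(1+γ)), 0, 2*I/(1+α)],
    ![-(2*I*γ/(1+γ)), (2*I)/(1-β), -(2*I/(1+α)), 0]]

/-- `x` satisfies the `A_{ℓ,p}`-relations: `x_μ x_ν = ℓ_{μν} x_ν x_μ + p_{μν} x_{ν'} x_{μ'}`. -/
def AlpRel {A : Type*} [Ring A] [Algebra ℂ A]
    (ℓ p : Fin 4 → Fin 4 → ℂ) (x : Fin 4 → A) : Prop :=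
  ∀ μ ν : Fin 4,
    x μ * x ν = ℓ μ ν • (x ν * x μ) + p μ ν • (x (pr μ ν).2 * x (pr μ ν).1)

/-- The coefficients `c₀ := 0`, `c₁ := ℓ₀₃(1+ℓ₀₁)`, `c₂ := 1+ℓ₀₂`, `c₃ := 1+ℓ₀₃`. -/
noncomputable def sklC (α β γ : ℂ) : Fin 4 → ℂ :=
  ![0, sklL α β γ 0 3 * (1 + sklL α β γ 0 1),
    1 + sklL α β γ 0 2, 1 + sklL α β γ 0 3]


/-- The Jacobi-type identity behind all four commutation checks. -/
lemma jac_aux {A : Type*} [Ring A] [Algebra ℂ A] (x y z w : A) (s t r : ℂ)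
    (h1 : x * y - y * x = s • (z * w + w * z))
    (h2 : w * z - z * w = t • (x * y + y * x)) (hr : s * t = r) :
    (x * (y * z + z * y) + (y * z + z * y) * x) - (y * (x * z + z * x) + (x * z + z * x) * y)
      = r • (z * (x * y + y * x) + (x * y + y * x) * z) := by
  have e1 : (x * (y * z + z * y) + (y * z + z * y) * x)
      - (y * (x * z + z * x) + (x * z + z * x) * y) = (x * y - y * x) * z - z * (x * y - y * x) := by
    noncomm_ring
  have e2 : (z * w + w * z) * z - z * (z * w + w * z) = z * (w * z - z * w) + (w * z - z * w) * z := by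
    noncomm_ring
  rw [e1, h1, smul_mul_assoc, mul_smul_comm, ← smul_sub, e2, h2, smul_mul_assoc, mul_smul_comm,
    ← smul_add, smul_smul, hr]

lemma sq_comm_aux {A : Type*} [Ring A] [Algebra ℂ A] (x y v : A) (s : ℂ)
    (h : x * y - y * x = s • v) :
    x * x * y - y * (x * x) = s • (x * v + v * x) := by
  have e : x * x * y - y * (x * x) = x * (x * y - y * x) + (x * y - y * x) * x := by noncomm_ring
  rw [e, h, smul_mul_assoc, mul_smul_comm, ← smul_add]

/-- A pair of mutually opposite `A_{ℓ,p}` relations gives a commutator relation. -/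
lemma rel_aux {A : Type*} [Ring A] [Algebra ℂ A] (a b u v : A) (l p q : ℂ)
    (h1 : a * b = l • (b * a) + p • u) (h2 : b * a = l • (a * b) + (-p) • v)
    (hl : 1 + l ≠ 0) (hq : p = (1 + l) * q) :
    a * b - b * a = q • (u + v) := by
  have h : (1 + l) • (a * b - b * a) = (1 + l) • (q • (u + v)) := by
    rw [smul_smul, ← hq]
    linear_combination (norm := module) h1 - h2
  exact smul_right_injective A hl h

lemma comm_aux {A : Type*} [Ring A] [Algebra ℂ A] (x0 x1 x2 x3 : A) (α β γ : ℂ)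
    (habc : α + β + γ + α * β * γ = 0)
    (h01 : x0 * x1 - x1 * x0 = (I * α) • (x2 * x3 + x3 * x2))
    (h02 : x0 * x2 - x2 * x0 = (I * β) • (x1 * x3 + x3 * x1))
    (h03 : x0 * x3 - x3 * x0 = (I * γ) • (x1 * x2 + x2 * x1))
    (h23 : x2 * x3 - x3 * x2 = I • (x0 * x1 + x1 * x0))
    (h13 : x1 * x3 - x3 * x1 = (-I) • (x0 * x2 + x2 * x0))
    (h12 : x1 * x2 - x2 * x1 = I • (x0 * x3 + x3 * x0)) (x : A)
    (hx : x = x0 ∨ x = x1 ∨ x = x2 ∨ x = x3) :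
    (1 - γ) • (x1 * x1 * x - x * (x1 * x1)) + (1 + α * γ) • (x2 * x2 * x - x * (x2 * x2))
      + (1 + α) • (x3 * x3 * x - x * (x3 * x3)) = 0 := by
  have h10 : x1 * x0 - x0 * x1 = (-(I * α)) • (x2 * x3 + x3 * x2) := by
    rw [neg_smul, ← h01, neg_sub]
  have h20 : x2 * x0 - x0 * x2 = (-(I * β)) • (x1 * x3 + x3 * x1) := by
    rw [neg_smul, ← h02, neg_sub]
  have h30 : x3 * x0 - x0 * x3 = (-(I * γ)) • (x1 * x2 + x2 * x1) := by
    rw [neg_smul, ← h03, neg_sub]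
  have h32 : x3 * x2 - x2 * x3 = (-I) • (x0 * x1 + x1 * x0) := by
    rw [neg_smul, ← h23, neg_sub]
  have h31 : x3 * x1 - x1 * x3 = I • (x0 * x2 + x2 * x0) := by
    rw [← neg_sub, h13, neg_smul, neg_neg]
  have h21 : x2 * x1 - x1 * x2 = (-I) • (x0 * x3 + x3 * x0) := by
    rw [neg_smul, ← h12, neg_sub]
  have hI : I * I = -1 := I_mul_I
  rcases hx with rfl | rfl | rfl | rfl
  · have k1 := sq_comm_aux _ _ _ _ h10
    have k2 := sq_comm_aux _ _ _ _ h20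
    have k3 := sq_comm_aux _ _ _ _ h30
    have j1 := jac_aux x1 x2 x3 x I (I * γ) (-γ) (by rw [h12, add_comm (x3 * x)]) h03
      (by linear_combination γ * hI)
    have j2 := jac_aux x2 x3 x1 x I (I * α) (-α) (by rw [h23, add_comm (x1 * x)]) h01
      (by linear_combination α * hI)
    rw [k1, k2, k3]
    simp only [add_comm (x3 * x1), add_comm (x2 * x1), add_comm (x3 * x2)] at j1 j2 ⊢
    generalize x1 * (x2 * x3 + x3 * x2) + (x2 * x3 + x3 * x2) * x1 = A1 at *
    generalize x2 * (x1 * x3 + x3 * x1) + (x1 * x3 + x3 * x1) * x2 = A2 at *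
    generalize x3 * (x1 * x2 + x2 * x1) + (x1 * x2 + x2 * x1) * x3 = A3 at *
    have hb : (1 + α * γ) • (-(I * β)) • A2 = (I * (α + γ)) • A2 := by
      rw [smul_smul]; congr 1; linear_combination (-I) * habc
    rw [hb]
    linear_combination (norm := module) (-(I * α)) • j1 + (I * γ) • j2
  · have k2 := sq_comm_aux _ _ _ _ h21
    have k3 := sq_comm_aux _ _ _ _ h31
    have j1 := jac_aux x2 x3 x0 x I (-(I * α)) α (by rw [h23]) h10
      (by linear_combination (-α) * hI)
    have j2 := jac_aux x0 x3 x2 x (I * γ) I (-γ) (by rw [h03, add_comm]) h12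
      (by linear_combination γ * hI)
    rw [k2, k3]
    simp only [add_comm (x3 * x0), add_comm (x2 * x0), add_comm (x3 * x2)] at j1 j2 ⊢
    generalize x0 * (x2 * x3 + x3 * x2) + (x2 * x3 + x3 * x2) * x0 = A1 at *
    generalize x2 * (x0 * x3 + x3 * x0) + (x0 * x3 + x3 * x0) * x2 = A2 at *
    generalize x3 * (x0 * x2 + x2 * x0) + (x0 * x2 + x2 * x0) * x3 = A3 at *
    linear_combination (norm := (simp only [mul_assoc, sub_self]; module)) (-I) • j1 - (I * α) • j2
  · have k1 := sq_comm_aux _ _ _ _ h12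
    have k3 := sq_comm_aux _ _ _ _ h32
    have j1 := jac_aux x0 x1 x3 x (I * α) I (-α) (by rw [h01, add_comm]) h23
      (by linear_combination α * hI)
    have j2 := jac_aux x0 x3 x1 x (I * γ) (-I) γ (by rw [h03]) h21
      (by linear_combination (-γ) * hI)
    rw [k1, k3]
    simp only [add_comm (x3 * x0), add_comm (x1 * x0), add_comm (x3 * x1)] at j1 j2 ⊢
    generalize x0 * (x1 * x3 + x3 * x1) + (x1 * x3 + x3 * x1) * x0 = A1 at *
    generalize x1 * (x0 * x3 + x3 * x0) + (x0 * x3 + x3 * x0) * x1 = A2 at *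
    generalize x3 * (x0 * x1 + x1 * x0) + (x0 * x1 + x1 * x0) * x3 = A3 at *
    linear_combination (norm := (simp only [mul_assoc, sub_self]; module)) I • j2 - I • j1
  · have k1 := sq_comm_aux _ _ _ _ h13
    have k2 := sq_comm_aux _ _ _ _ h23
    have j1 := jac_aux x1 x2 x0 x I (-(I * γ)) γ (by rw [h12]) h30
      (by linear_combination (-γ) * hI)
    have j2 := jac_aux x0 x1 x2 x (I * α) (-I) α (by rw [h01]) h32
      (by linear_combination (-α) * hI)
    rw [k1, k2]
    simp only [add_comm (x2 * x0), add_comm (x1 * x0), add_comm (x2 * x1)] at j1 j2 ⊢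
    generalize x0 * (x1 * x2 + x2 * x1) + (x1 * x2 + x2 * x1) * x0 = A1 at *
    generalize x1 * (x0 * x2 + x2 * x0) + (x0 * x2 + x2 * x0) * x1 = A2 at *
    generalize x2 * (x0 * x1 + x1 * x0) + (x0 * x1 + x1 * x0) * x2 = A3 at *
    linear_combination (norm := (simp only [mul_assoc, sub_self]; module)) (-I) • j1 - (I * γ) • j2

/-- Lemma 4.8: under `α + β + γ + αβγ = 0`, for each `ν`
`(c_{μ_ν} − c_{ν̃}) p_{μ_ν ν} + (c_{μ̃_ν} − c_{ν̃}) p_{μ̃_ν ν} = 0`; consequently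
`ℓ₀₃(1+ℓ₀₁) x₁² + (1+ℓ₀₂) x₂² + (1+ℓ₀₃) x₃²` commutes with every `x_ν` whenever
`x` satisfies the `A_{ℓ,p}`-relations for these parameters. -/
theorem stmt10 (α β γ : ℂ) (hα : α ≠ -1) (hβ : β ≠ 1) (hγ : γ ≠ -1)
    (habc : α + β + γ + α * β * γ = 0) :
    (∀ ν : Fin 4,
      (sklC α β γ (tnu ν).2.1 - sklC α β γ (tnu ν).1) * sklP α β γ (tnu ν).2.1 ν +
        (sklC α β γ (tnu ν).2.2 - sklC α β γ (tnu ν).1) * sklP α β γ (tnu ν).2.2 ν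
          = 0) ∧
    (∀ (A : Type*) [Ring A] [Algebra ℂ A], ∀ x : Fin 4 → A,
      AlpRel (sklL α β γ) (sklP α β γ) x →
      ∀ ν : Fin 4,
        ((sklL α β γ 0 3 * (1 + sklL α β γ 0 1)) • (x 1 * x 1) +
          (1 + sklL α β γ 0 2) • (x 2 * x 2) +
          (1 + sklL α β γ 0 3) • (x 3 * x 3)) * x ν =
        x ν * ((sklL α β γ 0 3 * (1 + sklL α β γ 0 1)) • (x 1 * x 1) +
          (1 + sklL α β γ 0 2) • (x 2 * x 2) +
          (1 + sklL α β γ 0 3) • (x 3 * x 3))) := by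
  have ha : 1 + α ≠ 0 := fun h => hα (by linear_combination h)
  have hb : 1 - β ≠ 0 := fun h => hβ (by linear_combination -h)
  have hc : 1 + γ ≠ 0 := fun h => hγ (by linear_combination h)
  have key : (1 - β) * (1 + α * γ) = (1 + α) * (1 + γ) := by linear_combination -habc
  have hd : 1 + α * γ ≠ 0 := fun h => by
    rw [h, mul_zero] at key
    exact mul_ne_zero ha hc key.symm
  have hβe : β = -(α + γ) / (1 + α * γ) := by
    field_simp
    linear_combination habc
  have hbi : 1 / (1 - β) = (1 + α * γ) / ((1 + α) * (1 + γ)) := by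
    field_simp
    linear_combination -key
  have hl01 : 1 + (1 - α) / (1 + α) = 2 / (1 + α) := by field_simp; ring
  have hl02 : 1 + (1 + β) / (1 - β) = 2 / (1 - β) := by field_simp; ring
  have hl03 : 1 + (1 - γ) / (1 + γ) = 2 / (1 + γ) := by field_simp; ring
  have hl02' : 2 / (1 - β) = 2 * (1 + α * γ) / ((1 + α) * (1 + γ)) := by
    linear_combination 2 * hbi
  have hp02 : 2 * I * β / (1 - β) = -(2 * I * (α + γ)) / ((1 + α) * (1 + γ)) := by
    field_simp
    linear_combination habc
  have hp13 : 2 * I / (1 - β) = 2 * I * (1 + α * γ) / ((1 + α) * (1 + γ)) := by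
    linear_combination 2 * I * hbi
  constructor
  · intro ν
    fin_cases ν <;> simp [sklC, sklP, sklL, tnu] <;>
      simp only [hl01, hl02, hl03, hl02', hp02, hp13, neg_div] <;> field_simp <;>
      (first | ring1 | linear_combination (-4 * I * γ * (1 + α)) * habc |
        linear_combination (-γ * (1 + α)) * habc | linear_combination (γ * (1 + α)) * habc)
  · intro A _ _ x hx ν
    have t1 : (2 : ℂ) / (1 + α) ≠ 0 := div_ne_zero two_ne_zero ha
    have t2 : (2 : ℂ) / (1 - β) ≠ 0 := div_ne_zero two_ne_zero hb
    have t3 : (2 : ℂ) / (1 + γ) ≠ 0 := div_ne_zero two_ne_zero hc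
    have h01 : x 0 * x 1 - x 1 * x 0 = (I * α) • (x 3 * x 2 + x 2 * x 3) :=
      rel_aux _ _ _ _ _ _ _ (hx 0 1) (hx 1 0) (by simpa [sklL, hl01] using ha)
        (by simp [sklL, sklP, hl01]; ring)
    have h02 : x 0 * x 2 - x 2 * x 0 = (I * β) • (x 3 * x 1 + x 1 * x 3) :=
      rel_aux _ _ _ _ _ _ _ (hx 0 2) (hx 2 0) (by simpa [sklL, hl02] using hb)
        (by simp [sklL, sklP, hl02]; ring)
    have h03 : x 0 * x 3 - x 3 * x 0 = (I * γ) • (x 2 * x 1 + x 1 * x 2) :=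
      rel_aux _ _ _ _ _ _ _ (hx 0 3) (hx 3 0) (by simpa [sklL, hl03] using hc)
        (by simp [sklL, sklP, hl03]; ring)
    have h23 : x 2 * x 3 - x 3 * x 2 = I • (x 1 * x 0 + x 0 * x 1) :=
      rel_aux _ _ _ _ _ _ _ (hx 2 3) (hx 3 2) (by simpa [sklL, hl01] using ha)
        (by simp [sklL, sklP, hl01]; ring)
    have h31 : x 3 * x 1 - x 1 * x 3 = I • (x 0 * x 2 + x 2 * x 0) :=
      rel_aux _ _ _ _ _ _ _ (hx 3 1)
        (by have := hx 1 3; simp only [sklL, sklP, pr, neg_div] at this ⊢; exact this)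
        (by simpa [sklL, hl02] using hb)
        (by simp [sklL, sklP, hl02]; ring)
    have h12 : x 1 * x 2 - x 2 * x 1 = I • (x 3 * x 0 + x 0 * x 3) :=
      rel_aux _ _ _ _ _ _ _ (hx 1 2) (hx 2 1) (by simpa [sklL, hl03] using hc)
        (by simp [sklL, sklP, hl03]; ring)
    have h13 : x 1 * x 3 - x 3 * x 1 = (-I) • (x 0 * x 2 + x 2 * x 0) := by
      rw [neg_smul, ← h31, neg_sub]
    have main := comm_aux (x 0) (x 1) (x 2) (x 3) α β γ habc
      (by rw [h01, add_comm]) (by rw [h02, add_comm]) (by rw [h03, add_comm])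
      (by rw [h23, add_comm]) h13 (by rw [h12, add_comm]) (x ν)
      (by fin_cases ν <;> simp)
    have c1 : sklL α β γ 0 3 * (1 + sklL α β γ 0 1) = 2 / ((1 + α) * (1 + γ)) * (1 - γ) := by
      simp [sklL, hl01]; field_simp
    have c2 : 1 + sklL α β γ 0 2 = 2 / ((1 + α) * (1 + γ)) * (1 + α * γ) := by
      simp [sklL, hl02, hl02']; field_simp
    have c3 : 1 + sklL α β γ 0 3 = 2 / ((1 + α) * (1 + γ)) * (1 + α) := by
      simp [sklL, hl03]; field_simp
    rw [c1, c2, c3]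
    simp only [add_mul, mul_add, smul_mul_assoc, mul_smul_comm]
    linear_combination (norm := module) (2 / ((1 + α) * (1 + γ))) • main
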